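/- Let G be a torsionfree abelian group, R a G-graded commutative Noetherian ring, and I a radical proper ideal of R which is not G-graded. Let I* be the ideal generated by all homogeneous elements of I. Then ir_R(I) ≥ ir_R(I*), and equality holds if and only if the map 𝔭 ↦ 𝔭* induces a bijection between Min(I) and Min(I*). -/

import Mathlib

/-- A submodule `N` of `M` is irreducible if whenever `N₁ ⊓ N₂ = N` for submodules `N₁, N₂` of
`M`, then `N₁ = N` or `N₂ = N`.  For `M = R` this is the notion of an irreducible ideal. -/
def SubmoduleIrreducible {R M : Type*} [Semiring R] [AddCommMonoid M] [Module R M]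
    (N : Submodule R M) : Prop :=
  ∀ N₁ N₂ : Submodule R M, N₁ ⊓ N₂ = N → N₁ = N ∨ N₂ = N

/-- The index of reducibility of `N` in `M`: the least `r` such that `N` is an intersection of
`r` irreducible submodules of `M`. -/
noncomputable def irIndex {R M : Type*} [Semiring R] [AddCommMonoid M] [Module R M]
    (N : Submodule R M) : ℕ :=
  sInf {r : ℕ | ∃ f : Fin r → Submodule R M,
    (∀ i, SubmoduleIrreducible (f i)) ∧ N = ⨅ i, f i}

/-- Every torsionfree abelian group carries a compatible linear order. -/
theorem exists_linearOrder_isOrderedCancelAddMonoid (G : Type*) [AddCommGroup G]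
    [IsAddTorsionFree G] : ∃ _ : LinearOrder G, IsOrderedCancelAddMonoid G := by
  let b := Module.Basis.ofVectorSpace ℚ (DivisibleHull G)
  let _ : LinearOrder (Module.Basis.ofVectorSpaceIndex ℚ (DivisibleHull G)) :=
    IsWellOrder.linearOrder WellOrderingRel
  let φ : G → Lex (Module.Basis.ofVectorSpaceIndex ℚ (DivisibleHull G) →₀ ℚ) :=
    fun g ↦ toLex (b.repr (g : DivisibleHull G))
  have hφ : Function.Injective φ :=
    toLex.injective.comp (b.repr.injective.comp DivisibleHull.coe_injective)
  have hadd (x y : G) : φ (x + y) = φ x + φ y := by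
    simp only [φ, DivisibleHull.coe_add, map_add, toLex_add]
  let _ : LinearOrder G := LinearOrder.lift' φ hφ
  exact ⟨_, Function.Injective.isOrderedCancelAddMonoid φ hadd Iff.rfl⟩

/-- The homogeneous core of a prime ideal is prime if the grading group is torsionfree. -/
theorem Ideal.IsPrime.homogeneousCore_of_isAddTorsionFree {G R : Type*} [AddCommGroup G]
    [inst : DecidableEq G] [IsAddTorsionFree G] [CommRing R] (𝒜 : G → AddSubgroup R) [GradedRing 𝒜]
    {P : Ideal R} (hP : P.IsPrime) : (P.homogeneousCore 𝒜).toIdeal.IsPrime := by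
  obtain ⟨_, _⟩ := exists_linearOrder_isOrderedCancelAddMonoid G
  obtain rfl : inst = LinearOrder.toDecidableEq := Subsingleton.elim _ _
  exact hP.homogeneousCore

theorem Ideal.IsPrime.submoduleIrreducible {R : Type*} [CommRing R] {P : Ideal R}
    (hP : P.IsPrime) : SubmoduleIrreducible (P : Submodule R R) := by
  intro J K hJK
  rcases hP.inf_le.mp hJK.le with h | h
  · exact Or.inl (le_antisymm h (hJK ▸ inf_le_left))
  · exact Or.inr (le_antisymm h (hJK ▸ inf_le_right))

/-- A proper irreducible ideal of a Noetherian ring has a prime radical. -/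
theorem SubmoduleIrreducible.isPrime_radical {R : Type*} [CommRing R] [IsNoetherianRing R]
    {J : Ideal R} (hJ : SubmoduleIrreducible (J : Submodule R R)) (hne : J ≠ ⊤) :
    J.radical.IsPrime := by
  have hirr : InfIrred (J : Submodule R R) := ⟨by simpa using hne, fun {K L} h ↦ hJ K L h⟩
  exact Ideal.isPrime_radical hirr.isPrimary

/-- In a Noetherian ring, any decomposition of `I` into irreducible ideals has at least as many
components as `I` has minimal primes. -/
theorem ncard_minimalPrimes_le_of_eq_iInf {R : Type*} [CommRing R] [IsNoetherianRing R]
    {I : Ideal R} {r : ℕ} {f : Fin r → Ideal R}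
    (hf : ∀ i, SubmoduleIrreducible (f i : Submodule R R)) (hI : I = ⨅ i, f i) :
    I.minimalPrimes.ncard ≤ r := by
  have hsub : I.minimalPrimes ⊆ Set.range fun i ↦ (f i).radical := by
    intro P hP
    have hPp : P.IsPrime := hP.1.1
    have hle : Finset.univ.inf f ≤ P := by
      rw [Finset.inf_univ_eq_iInf, ← hI]
      exact hP.1.2
    obtain ⟨i, -, hi⟩ := hPp.inf_le'.mp hle
    have hrad : (f i).radical ≤ P := hPp.radical_le_iff.mpr hi
    have hprime := (hf i).isPrime_radical (ne_top_of_le_ne_top hPp.ne_top hi)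
    have hIi : I ≤ f i := hI ▸ iInf_le f i
    exact ⟨i, le_antisymm hrad (hP.2 ⟨hprime, hIi.trans Ideal.le_radical⟩ hrad)⟩
  calc I.minimalPrimes.ncard ≤ (Set.range fun i ↦ (f i).radical).ncard :=
        Set.ncard_le_ncard hsub (Set.finite_range _)
    _ ≤ Nat.card (Fin r) := by
        rw [← Set.image_univ, ← Set.ncard_univ]
        exact Set.ncard_image_le
    _ = r := Nat.card_fin r

/-- The index of reducibility of a radical ideal is its number of minimal primes. -/
theorem Ideal.IsRadical.irIndex_eq_ncard_minimalPrimes {R : Type*} [CommRing R]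
    [IsNoetherianRing R] {I : Ideal R} (hI : I.IsRadical) :
    irIndex (I : Submodule R R) = I.minimalPrimes.ncard := by
  have hfin := I.finite_minimalPrimes_of_isNoetherianRing R
  have : Finite I.minimalPrimes := hfin
  let e : I.minimalPrimes ≃ Fin I.minimalPrimes.ncard := Finite.equivFin _
  have hmem : I.minimalPrimes.ncard ∈ {r : ℕ | ∃ f : Fin r → Submodule R R,
      (∀ i, SubmoduleIrreducible (f i)) ∧ I = ⨅ i, f i} := by
    refine ⟨fun i ↦ (e.symm i : Ideal R), fun i ↦ (e.symm i).2.1.1.submoduleIrreducible, ?_⟩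
    rw [e.symm.iInf_comp (g := fun P : I.minimalPrimes ↦ (P : Ideal R)), ← sInf_eq_iInf',
      Ideal.sInf_minimalPrimes, hI.radical]
  refine le_antisymm (Nat.sInf_le hmem) (le_csInf ⟨_, hmem⟩ ?_)
  rintro r ⟨f, hf, h⟩
  exact ncard_minimalPrimes_le_of_eq_iInf hf h

section HomogeneousCore

variable {G R : Type*} [AddCommGroup G] [DecidableEq G] [CommRing R] (𝒜 : G → AddSubgroup R)
  [GradedRing 𝒜]

/-- The homogeneous core of a radical ideal is the intersection of the homogeneous cores of its
minimal primes. -/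
theorem Ideal.IsRadical.toIdeal_homogeneousCore_eq_sInf {I : Ideal R} (hI : I.IsRadical) :
    (I.homogeneousCore 𝒜).toIdeal =
      sInf ((fun P : Ideal R ↦ (P.homogeneousCore 𝒜).toIdeal) '' I.minimalPrimes) := by
  apply le_antisymm
  · refine le_sInf ?_
    rintro _ ⟨P, hP, rfl⟩
    exact Ideal.homogeneousCore_mono 𝒜 hP.1.2
  · have hhom : (sInf ((fun P : Ideal R ↦ (P.homogeneousCore 𝒜).toIdeal) ''
        I.minimalPrimes)).IsHomogeneous 𝒜 := by
      refine Ideal.IsHomogeneous.sInf ?_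
      rintro _ ⟨P, -, rfl⟩
      exact HomogeneousIdeal.isHomogeneous _
    rw [← hhom.toIdeal_homogeneousCore_eq_self]
    refine Ideal.homogeneousCore_mono 𝒜 ?_
    conv_rhs => rw [← hI.radical, ← Ideal.sInf_minimalPrimes]
    exact le_sInf fun P hP ↦
      (sInf_le (Set.mem_image_of_mem _ hP)).trans (P.toIdeal_homogeneousCore_le 𝒜)

/-- The homogeneous core of a radical ideal is radical if the grading group is torsionfree. -/
theorem Ideal.IsRadical.toIdeal_homogeneousCore [IsAddTorsionFree G] {I : Ideal R}
    (hI : I.IsRadical) : (I.homogeneousCore 𝒜).toIdeal.IsRadical := by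
  refine Ideal.radical_eq_iff.mp (le_antisymm ?_ Ideal.le_radical)
  conv_rhs => rw [hI.toIdeal_homogeneousCore_eq_sInf 𝒜]
  refine le_sInf ?_
  rintro _ ⟨P, hP, rfl⟩
  have hprime := Ideal.IsPrime.homogeneousCore_of_isAddTorsionFree 𝒜 hP.1.1
  exact hprime.radical_le_iff.mpr (Ideal.homogeneousCore_mono 𝒜 hP.1.2)

/-- Every minimal prime of the homogeneous core of a radical ideal `I` is the homogeneous core of
a minimal prime of `I`. -/
theorem Ideal.IsRadical.minimalPrimes_homogeneousCore_subset [IsAddTorsionFree G]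
    [IsNoetherianRing R] {I : Ideal R} (hI : I.IsRadical) :
    (I.homogeneousCore 𝒜).toIdeal.minimalPrimes ⊆
      (fun P : Ideal R ↦ (P.homogeneousCore 𝒜).toIdeal) '' I.minimalPrimes := by
  intro Q hQ
  have hfin := I.finite_minimalPrimes_of_isNoetherianRing R
  have hQp : Q.IsPrime := hQ.1.1
  have hle : hfin.toFinset.inf (fun P : Ideal R ↦ (P.homogeneousCore 𝒜).toIdeal) ≤ Q := by
    refine le_trans ?_ hQ.1.2
    rw [hI.toIdeal_homogeneousCore_eq_sInf 𝒜]
    refine le_sInf ?_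
    rintro _ ⟨P, hP, rfl⟩
    exact Finset.inf_le (hfin.mem_toFinset.mpr hP)
  obtain ⟨P, hP, hPQ⟩ := hQp.inf_le'.mp hle
  rw [hfin.mem_toFinset] at hP
  exact ⟨P, hP, le_antisymm hPQ (hQ.2
    ⟨Ideal.IsPrime.homogeneousCore_of_isAddTorsionFree 𝒜 hP.1.1,
      Ideal.homogeneousCore_mono 𝒜 hP.1.2⟩ hPQ)⟩

end HomogeneousCore

/-- If a finite set `s` maps onto a superset of `t` and has the same cardinality as `t`, then the
map is a bijection from `s` to `t`. -/
theorem Set.bijOn_of_subset_image_of_ncard_eq {α β : Type*} {f : α → β} {s : Set α} {t : Set β}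
    (hs : s.Finite) (hst : t ⊆ f '' s) (h : s.ncard = t.ncard) : Set.BijOn f s t := by
  have hle : (f '' s).ncard ≤ s.ncard := Set.ncard_image_le hs
  have himage : t = f '' s := Set.eq_of_subset_of_ncard_le hst (h ▸ hle) (hs.image f)
  subst himage
  exact ((Set.ncard_image_iff hs).mp h.symm).bijOn_image

/-- Let `G` be a torsionfree abelian group, `R` a `G`-graded commutative Noetherian ring and `I`
a radical proper ideal of `R` which is not `G`-graded.  Let `I*` be the ideal generated by all
homogeneous elements of `I`.  Then `ir_R(I) ≥ ir_R(I*)`, and equality holds if and only if the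
map `𝔭 ↦ 𝔭*` induces a bijection between `Min(I)` and `Min(I*)`. -/
theorem irIndex_homogeneousCore_le_and_eq_iff
    {G R : Type*} [AddCommGroup G] [DecidableEq G] [CommRing R] [IsNoetherianRing R]
    (𝒜 : G → AddSubgroup R) [GradedRing 𝒜]
    (hG : ∀ (n : ℕ) (g : G), 0 < n → n • g = 0 → g = 0)
    (I : Ideal R) (hrad : I.radical = I) (hproper : I ≠ ⊤)
    (hngr : ¬ Ideal.IsHomogeneous 𝒜 I) :
    irIndex ((I.homogeneousCore 𝒜).toIdeal : Submodule R R) ≤ irIndex (I : Submodule R R) ∧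
      (irIndex (I : Submodule R R) = irIndex ((I.homogeneousCore 𝒜).toIdeal : Submodule R R) ↔
        Set.BijOn (fun 𝔭 : Ideal R => (𝔭.homogeneousCore 𝒜).toIdeal)
          I.minimalPrimes ((I.homogeneousCore 𝒜).toIdeal).minimalPrimes) := by
  have : IsAddTorsionFree G := by
    refine IsAddTorsionFree.of_not_isOfFinAddOrder fun g hg hfin ↦ hg ?_
    obtain ⟨n, hn, hng⟩ := isOfFinAddOrder_iff_nsmul_eq_zero.mp hfin
    exact hG n g hn hng
  have hI : I.IsRadical := Ideal.radical_eq_iff.mp hrad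
  have hfin := I.finite_minimalPrimes_of_isNoetherianRing R
  have hsub := hI.minimalPrimes_homogeneousCore_subset 𝒜
  rw [hI.irIndex_eq_ncard_minimalPrimes,
    (hI.toIdeal_homogeneousCore 𝒜).irIndex_eq_ncard_minimalPrimes]
  exact ⟨(Set.ncard_le_ncard hsub (hfin.image _)).trans (Set.ncard_image_le hfin),
    Set.bijOn_of_subset_image_of_ncard_eq hfin hsub, fun h ↦ by
      rw [← h.image_eq, h.injOn.ncard_image]⟩
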